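/- For every N ≥ 1, site percolation on the triangular torus at parameter p = 1/2 satisfies ℙ_{1/2}(A^△) ≥ 1/2. -/

import Mathlib

/-!
Site percolation on the triangular torus.  A configuration assigns open/closed to
each vertex of `(ℤ/Nℤ)²`, where two vertices are adjacent when they differ by
`±(1,0)`, `±(0,1)` or `±(1,1)` modulo `N`.  A configuration lifts `N`-periodically
to the triangular lattice on `ℤ²`, and the giant-cycle event `A^△` asks for two
distinct points of `ℤ²`, congruent mod `N`, joined by a path of consecutively
adjacent open vertices of the periodic lift.
-/

namespace TriSite

/-- A site configuration on the triangular torus. -/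
abbrev Config (N : ℕ) := (Fin 2 → ZMod N) → Bool

/-- Reduction of a point of `ℤ²` modulo `N`. -/
def proj (N : ℕ) (x : Fin 2 → ℤ) : Fin 2 → ZMod N := fun i => (x i : ZMod N)

/-- Adjacency in the triangular lattice on `ℤ²`. -/
def adj (x y : Fin 2 → ℤ) : Prop :=
  y - x = ![1, 0] ∨ y - x = ![-1, 0] ∨ y - x = ![0, 1] ∨ y - x = ![0, -1] ∨
    y - x = ![1, 1] ∨ y - x = ![-1, -1]

/-- The point `x` of `ℤ²` is open in the periodic lift. -/
def siteOpen (N : ℕ) (ω : Config N) (x : Fin 2 → ℤ) : Prop := ω (proj N x) = true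

/-- One step between adjacent open vertices of the periodic lift. -/
def step (N : ℕ) (ω : Config N) (x y : Fin 2 → ℤ) : Prop :=
  adj x y ∧ siteOpen N ω x ∧ siteOpen N ω y

/-- Connectivity by paths of consecutively adjacent open vertices of the lift. -/
def connected (N : ℕ) (ω : Config N) : (Fin 2 → ℤ) → (Fin 2 → ℤ) → Prop :=
  Relation.ReflTransGen (step N ω)

/-- The giant-cycle event `A^△`. -/
def giantEvent (N : ℕ) : Set (Config N) :=
  {ω | ∃ x y : Fin 2 → ℤ, x ≠ y ∧ proj N x = proj N y ∧ connected N ω x y}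

/-- The set of winding vectors realized by a configuration. -/
def winding (N : ℕ) (ω : Config N) : Set (Fin 2 → ℤ) :=
  {w | ∃ x : Fin 2 → ℤ, connected N ω x (x + (N : ℤ) • w)}

/-- The spanning event `S^△`: the realized winding vectors span `ℚ²`. -/
def spanEvent (N : ℕ) : Set (Config N) :=
  {ω | Submodule.span ℚ
    ((fun w : Fin 2 → ℤ => fun i => (w i : ℚ)) '' winding N ω) = ⊤}

/-- The probability of an event under Bernoulli(`p`) site percolation:
each site is open independently with probability `p`. -/
noncomputable def prob (N : ℕ) (p : ℝ) (S : Set (Config N)) : ℝ :=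
  ∑ᶠ ω ∈ S, ∏ᶠ v : Fin 2 → ZMod N, (if ω v then p else 1 - p)

end TriSite

namespace TriSite

/-- One step between adjacent vertices of the same colour. -/
def mstep (N : ℕ) (ω : Config N) (x y : Fin 2 → ℤ) : Prop :=
  adj x y ∧ ω (proj N x) = ω (proj N y)

/-- Monochromatic connectivity in the lift. -/
def mconn (N : ℕ) (ω : Config N) : (Fin 2 → ℤ) → (Fin 2 → ℤ) → Prop :=
  Relation.ReflTransGen (mstep N ω)

/-- The flipped configuration. -/
def flip (N : ℕ) (ω : Config N) : Config N := fun v => !(ω v)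

lemma flip_flip (N : ℕ) (ω : Config N) : flip N (flip N ω) = ω := by
  funext v; simp [flip]

lemma proj_add (N : ℕ) (x y : Fin 2 → ℤ) : proj N (x + y) = proj N x + proj N y := by
  funext i; simp [proj]

lemma proj_sub (N : ℕ) (x y : Fin 2 → ℤ) : proj N (x - y) = proj N x - proj N y := by
  funext i; simp [proj]

lemma proj_surj (N : ℕ) (v : Fin 2 → ZMod N) : ∃ x, proj N x = v := by
  choose f hf using fun i => ZMod.intCast_surjective (v i)
  exact ⟨f, funext hf⟩

lemma adj_symm {x y : Fin 2 → ℤ} (h : adj x y) : adj y x := by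
  have e : x - y = -(y - x) := by abel
  unfold adj at *
  rw [e]
  rcases h with h | h | h | h | h | h <;> rw [h] <;> simp

lemma mconn_symm {N : ℕ} {ω : Config N} {x y : Fin 2 → ℤ} (h : mconn N ω x y) :
    mconn N ω y x := by
  induction h with
  | refl => exact Relation.ReflTransGen.refl
  | tail _ h2 ih => exact Relation.ReflTransGen.head ⟨adj_symm h2.1, h2.2.symm⟩ ih

lemma mconn_translate {N : ℕ} {ω : Config N} {x y : Fin 2 → ℤ} (t : Fin 2 → ℤ)
    (ht : proj N t = 0) (h : mconn N ω x y) : mconn N ω (x + t) (y + t) := by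
  induction h with
  | refl => exact Relation.ReflTransGen.refl
  | tail _ h2 ih =>
    refine Relation.ReflTransGen.tail ih ⟨?_, ?_⟩
    · have := h2.1
      unfold adj at *
      simpa using this
    · rw [proj_add, proj_add, ht, add_zero, add_zero]; exact h2.2

lemma mconn_connected {N : ℕ} {ω : Config N} {x y : Fin 2 → ℤ} (h : mconn N ω x y)
    (hx : ω (proj N x) = true) : connected N ω x y ∧ ω (proj N y) = true := by
  induction h with
  | refl => exact ⟨Relation.ReflTransGen.refl, hx⟩
  | tail _ h2 ih =>
    have := h2.2 ▸ ih.2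
    exact ⟨Relation.ReflTransGen.tail ih.1 ⟨h2.1, ih.2, this⟩, this⟩

lemma mconn_flip {N : ℕ} {ω : Config N} {x y : Fin 2 → ℤ} (h : mconn N ω x y) :
    mconn N (flip N ω) x y := by
  induction h with
  | refl => exact Relation.ReflTransGen.refl
  | tail _ h2 ih => exact Relation.ReflTransGen.tail ih ⟨h2.1, by simp [flip, h2.2]⟩

lemma mconn_unique {N : ℕ} {ω : Config N} (h1 : ω ∉ giantEvent N)
    (h2 : flip N ω ∉ giantEvent N) {x y : Fin 2 → ℤ} (h : mconn N ω x y)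
    (hp : proj N x = proj N y) : x = y := by
  by_contra hne
  cases hx : ω (proj N x) with
  | true => exact h1 ⟨x, y, hne, hp, (mconn_connected h hx).1⟩
  | false => exact h2 ⟨x, y, hne, hp, (mconn_connected (mconn_flip h) (by simp [flip, hx])).1⟩

/-- The relation on the torus induced by monochromatic connectivity. -/
def torusSetoid (N : ℕ) (ω : Config N) : Setoid (Fin 2 → ZMod N) where
  r v w := ∃ x y, proj N x = v ∧ proj N y = w ∧ mconn N ω x y
  iseqv :=
    { refl := fun v => by
        obtain ⟨x, hx⟩ := proj_surj N v
        exact ⟨x, x, hx, hx, Relation.ReflTransGen.refl⟩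
      symm := by
        rintro v w ⟨x, y, hx, hy, h⟩
        exact ⟨y, x, hy, hx, mconn_symm h⟩
      trans := by
        rintro u v w ⟨x, y, hx, hy, h⟩ ⟨y', z, hy', hz, h'⟩
        have ht : proj N (y - y') = 0 := by rw [proj_sub, hy, hy', sub_self]
        refine ⟨x, z + (y - y'), hx, by rw [proj_add, ht, hz, add_zero], ?_⟩
        have := mconn_translate _ ht h'
        rw [add_sub_cancel] at this
        exact Relation.ReflTransGen.trans h this }

/-- An equivariant retraction collapsing monochromatic clusters. -/
lemma exists_collapse {N : ℕ} {ω : Config N} (h1 : ω ∉ giantEvent N)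
    (h2 : flip N ω ∉ giantEvent N) :
    ∃ h : (Fin 2 → ℤ) → (Fin 2 → ℤ), (∀ x y, mstep N ω x y → h x = h y) ∧
      ∀ x t, proj N t = 0 → h (x + t) = h x + t := by
  let r : (Fin 2 → ZMod N) → (Fin 2 → ZMod N) :=
    fun v => (Quotient.mk (torusSetoid N ω) v).out
  have hr : ∀ x y, mconn N ω x y → r (proj N x) = r (proj N y) := by
    intro x y hxy
    have : Quotient.mk (torusSetoid N ω) (proj N x) = Quotient.mk (torusSetoid N ω) (proj N y) :=
      Quotient.sound ⟨x, y, rfl, rfl, hxy⟩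
    simp only [r, this]
  have hex : ∀ x, ∃ y, mconn N ω x y ∧ proj N y = r (proj N x) := by
    intro x
    have : (torusSetoid N ω).r (r (proj N x)) (proj N x) :=
      Quotient.mk_out (s := torusSetoid N ω) (proj N x)
    obtain ⟨a, b, ha, hb, hab⟩ := this
    have ht : proj N (x - b) = 0 := by rw [proj_sub, hb, sub_self]
    refine ⟨a + (x - b), ?_, by rw [proj_add, ht, ha, add_zero]⟩
    have := mconn_translate _ ht (mconn_symm hab)
    rwa [add_sub_cancel] at this
  choose h hc hp using hex
  refine ⟨h, ?_, ?_⟩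
  · intro x y hxy
    have hxy' : mconn N ω x y := Relation.ReflTransGen.single hxy
    apply mconn_unique h1 h2 (((mconn_symm (hc x)).trans hxy').trans (hc y))
    rw [hp, hp, hr _ _ hxy']
  · intro x t ht
    apply mconn_unique h1 h2 ((mconn_symm (hc (x + t))).trans (mconn_translate t ht (hc x)))
    rw [hp, proj_add, proj_add, ht, hp, add_zero, add_zero]

/-- Discrete area identity on the torus. -/
lemma area_identity {T : Type*} [AddCommGroup T] [Fintype T] (e f : T) (a b : T → ℤ) :
    ∑ v : T, ((1 + a (v + e + f) - a v) * (1 + b (v + f) - b (v + e))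
      - (1 + b (v + e + f) - b v) * (-1 + a (v + f) - a (v + e))) = 2 * Fintype.card T := by
  have sh : ∀ (t : T) (F : T → ℤ), ∑ v, F (v + t) = ∑ v, F v := fun t F =>
    Equiv.sum_comp (Equiv.addRight t) F
  have c1 := sh f (fun v => a v * b (v + e) - b v * a (v + e))
  have c2 := sh e (fun v => a v * b (v + f) - b v * a (v + f))
  have a1 := sh e a
  have a2 := sh f a
  have a3 := sh (e + f) a
  have b1 := sh e b
  have b2 := sh f b
  have b3 := sh (e + f) b
  have k : ∑ v : T, (2 : ℤ) = 2 * Fintype.card T := by simp [mul_comm]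
  have comm : ∀ v : T, v + f + e = v + e + f := fun v => by abel
  simp only [← add_assoc, comm] at c1 c2 a1 a2 a3 b1 b2 b3
  rw [← k]
  rw [← sub_eq_zero, ← Finset.sum_sub_distrib]
  have key : ∀ v : T, ((1 + a (v + e + f) - a v) * (1 + b (v + f) - b (v + e))
      - (1 + b (v + e + f) - b v) * (-1 + a (v + f) - a (v + e))) - 2 =
      - (a (v + f) * b (v + e + f) - b (v + f) * a (v + e + f) - (a v * b (v + e) - b v * a (v + e)))
      + (a (v + e) * b (v + e + f) - b (v + e) * a (v + e + f) - (a v * b (v + f) - b v * a (v + f)))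
      + (a (v + e + f) - a v) + (a (v + e) - a v) - (a (v + f) - a v)
      + (b (v + e + f) - b v) - (b (v + e) - b v) + (b (v + f) - b v) := fun v => by ring
  simp only [key, Finset.sum_add_distrib, Finset.sum_sub_distrib, Finset.sum_neg_distrib] at *
  linarith

lemma degenerate (P Q R : Fin 2 → ℤ) (h : P = Q ∨ P = R ∨ Q = R) :
    (Q 0 - P 0) * (R 1 - P 1) - (Q 1 - P 1) * (R 0 - P 0) = 0 := by
  rcases h with rfl | rfl | rfl <;> ring

lemma flip_or (N : ℕ) (hN : 1 ≤ N) (ω : Config N) :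
    ω ∈ giantEvent N ∨ flip N ω ∈ giantEvent N := by
  by_contra hcon
  push Not at hcon
  haveI : NeZero N := ⟨by omega⟩
  obtain ⟨h, hs, ht⟩ := exists_collapse hcon.1 hcon.2
  choose L hL using proj_surj N
  let p : (Fin 2 → ZMod N) → Fin 2 → ℤ := fun v => h (L v) - L v
  have hp : ∀ x, h x = x + p (proj N x) := by
    intro x
    have h0 : proj N (x - L (proj N x)) = 0 := by rw [proj_sub, hL, sub_self]
    have := ht (L (proj N x)) _ h0
    rw [add_sub_cancel] at this
    rw [this]; simp only [p]; abel
  have area := area_identity (proj N ![1, 0]) (proj N ![0, 1]) (fun v => p v 0) (fun v => p v 1)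
  rw [Finset.sum_eq_zero] at area
  · have : 0 < Fintype.card (Fin 2 → ZMod N) := Fintype.card_pos
    omega
  intro v _
  set x := L v with hx
  have hv : proj N x = v := hL v
  have q0 := hp x
  have q1 := hp (x + ![1, 0])
  have q2 := hp (x + ![0, 1])
  have q3 := hp (x + ![1, 0] + ![0, 1])
  simp only [proj_add, hv] at q1 q2 q3 q0
  have s01 : ω (proj N x) = ω (proj N (x + ![1, 0])) → h x = h (x + ![1, 0]) := fun hh =>
    hs _ _ ⟨by unfold adj; simp, hh⟩
  have s02 : ω (proj N x) = ω (proj N (x + ![0, 1])) → h x = h (x + ![0, 1]) := fun hh =>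
    hs _ _ ⟨by unfold adj; simp, hh⟩
  have s03 : ω (proj N x) = ω (proj N (x + ![1, 0] + ![0, 1])) →
      h x = h (x + ![1, 0] + ![0, 1]) := fun hh =>
    hs _ _ ⟨by unfold adj; simp [add_assoc], hh⟩
  have s13 : ω (proj N (x + ![1, 0])) = ω (proj N (x + ![1, 0] + ![0, 1])) →
      h (x + ![1, 0]) = h (x + ![1, 0] + ![0, 1]) := fun hh =>
    hs _ _ ⟨by unfold adj; simp, hh⟩
  have s23 : ω (proj N (x + ![0, 1])) = ω (proj N (x + ![1, 0] + ![0, 1])) →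
      h (x + ![0, 1]) = h (x + ![1, 0] + ![0, 1]) := fun hh =>
    hs _ _ ⟨by
      have : x + ![1, 0] + ![0, 1] - (x + ![0, 1]) = ![1, 0] := by abel
      unfold adj; rw [this]; simp, hh⟩
  have bool3 : ∀ a b c : Bool, a = b ∨ a = c ∨ b = c := by decide
  have t1 : h x = h (x + ![1, 0]) ∨ h x = h (x + ![1, 0] + ![0, 1]) ∨
      h (x + ![1, 0]) = h (x + ![1, 0] + ![0, 1]) :=
    (bool3 _ _ _).imp s01 (Or.imp s03 s13)
  have t2 : h x = h (x + ![0, 1]) ∨ h x = h (x + ![1, 0] + ![0, 1]) ∨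
      h (x + ![0, 1]) = h (x + ![1, 0] + ![0, 1]) :=
    (bool3 _ _ _).imp s02 (Or.imp s03 s23)
  rw [q0, q1, q3] at t1
  rw [q0, q2, q3] at t2
  have A1 : (1 + p (v + proj N ![1, 0]) 0 - p v 0) *
      (1 + p (v + proj N ![1, 0] + proj N ![0, 1]) 1 - p v 1) -
      (p (v + proj N ![1, 0]) 1 - p v 1) *
      (1 + p (v + proj N ![1, 0] + proj N ![0, 1]) 0 - p v 0) = 0 := by
    have d := degenerate _ _ _ t1
    simp only [Pi.add_apply, Matrix.cons_val_zero, Matrix.cons_val_one] at d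
    linear_combination d
  have A2 : (1 + p (v + proj N ![1, 0] + proj N ![0, 1]) 0 - p v 0) *
      (1 + p (v + proj N ![0, 1]) 1 - p v 1) -
      (p (v + proj N ![0, 1]) 0 - p v 0) *
      (1 + p (v + proj N ![1, 0] + proj N ![0, 1]) 1 - p v 1) = 0 := by
    have d := degenerate _ _ _ t2
    simp only [Pi.add_apply, Matrix.cons_val_zero, Matrix.cons_val_one] at d
    linear_combination (-1) * d
  linear_combination A1 + A2

end TriSite

/-- For every `N ≥ 1`, site percolation on the triangular torus at parameter
`p = 1/2` satisfies `ℙ_{1/2}(A^△) ≥ 1/2`. -/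
theorem triangular_site_half_giant_prob_ge_half (N : ℕ) (hN : 1 ≤ N) :
    1 / 2 ≤ TriSite.prob N (1 / 2) (TriSite.giantEvent N) := by
  classical
  haveI : NeZero N := ⟨by omega⟩
  have hw : ∀ ω : TriSite.Config N,
      (∏ᶠ v : Fin 2 → ZMod N, (if ω v then (1 / 2 : ℝ) else 1 - 1 / 2))
        = (1 / 2) ^ Fintype.card (Fin 2 → ZMod N) := by
    intro ω
    rw [finprod_eq_prod_of_fintype]
    have : ∀ v, (if ω v then (1 / 2 : ℝ) else 1 - 1 / 2) = 1 / 2 := by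
      intro v; split_ifs <;> norm_num
    simp only [this, Finset.prod_const, Finset.card_univ]
  unfold TriSite.prob
  simp only [hw]
  rw [finsum_mem_eq_toFinset_sum]
  rw [Finset.sum_const, nsmul_eq_mul]
  set S := (TriSite.giantEvent N).toFinset with hS
  have hcard : Fintype.card (TriSite.Config N) ≤ S.card + S.card := by
    have hsub : (Finset.univ : Finset (TriSite.Config N)) ⊆ S ∪ S.image (TriSite.flip N) := by
      intro ω _
      rcases TriSite.flip_or N hN ω with h | h
      · exact Finset.mem_union_left _ (by simpa [hS] using h)
      · exact Finset.mem_union_right _ (Finset.mem_image.2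
          ⟨_, by simpa [hS] using h, TriSite.flip_flip N ω⟩)
    calc Fintype.card (TriSite.Config N) = (Finset.univ : Finset (TriSite.Config N)).card := rfl
      _ ≤ (S ∪ S.image (TriSite.flip N)).card := Finset.card_le_card hsub
      _ ≤ S.card + (S.image (TriSite.flip N)).card := Finset.card_union_le _ _
      _ ≤ S.card + S.card := Nat.add_le_add_left Finset.card_image_le _
  have hc : Fintype.card (TriSite.Config N) = 2 ^ Fintype.card (Fin 2 → ZMod N) := by
    rw [Fintype.card_fun, Fintype.card_bool]
  rw [hc] at hcard
  have hcR : (2 : ℝ) ^ Fintype.card (Fin 2 → ZMod N) ≤ S.card + S.card := by exact_mod_cast hcard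
  rw [one_div_pow, mul_one_div, le_div_iff₀ (by positivity)]
  linarith
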